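/- For every even integer 2N ≥ 3×10^6, the number s of composites of type P relative to 2N is strictly greater than the number h of primes of type P relative to 2N, i.e., card X_{2N} > card P_{2N}. -/

import Mathlib

/-- `p` is a prime of type P relative to the even integer `n = 2N`:
`p` is prime, `3 ≤ p < n - 2`, and `p` does not divide `n`. -/
def PrimeTypeP (n p : ℕ) : Prop :=
  p.Prime ∧ 3 ≤ p ∧ p < n - 2 ∧ ¬ p ∣ n

/-- `a` is an integer of type P relative to the even integer `n = 2N`:
`1 < a < n - 2` and every prime factor of `a` is a prime of type P relative to `n`. -/
def IntTypeP (n a : ℕ) : Prop :=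
  1 < a ∧ a < n - 2 ∧ ∀ p : ℕ, p.Prime → p ∣ a → PrimeTypeP n p

/-- `x` is a composite of type P relative to the even integer `n = 2N`:
`x` is composite (greater than 1 and not prime), `1 < x < n - 2`, and every prime
factor of `x` is a prime of type P relative to `n`. -/
def CompositeTypeP (n x : ℕ) : Prop :=
  1 < x ∧ ¬ x.Prime ∧ x < n - 2 ∧ ∀ p : ℕ, p.Prime → p ∣ x → PrimeTypeP n p

open scoped ArithmeticFunction.vonMangoldt Chebyshev Nat.Prime
open Finset

theorem log_factorial_eq_sum_vonMangoldt {M N : ℕ} (h : M ≤ N) :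
    Real.log (M.factorial) = ∑ k ∈ Ioc 0 N, Λ k * ((M / k : ℕ) : ℝ) := by
  have h₁ : Real.log (M.factorial) = ∑ k ∈ Ioc 0 M, Real.log k := by
    clear h
    induction M with
    | zero => simp
    | succ M ih =>
      rw [Finset.sum_Ioc_succ_top (Nat.zero_le M), ← ih, Nat.factorial_succ, Nat.cast_mul,
        Real.log_mul (by positivity) (by positivity), add_comm]
  have h₂ := ArithmeticFunction.sum_Ioc_mul_zeta_eq_sum (R := ℝ) Λ M
  rw [ArithmeticFunction.vonMangoldt_mul_zeta] at h₂
  simp only [ArithmeticFunction.log_apply] at h₂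
  rw [h₁, h₂]
  refine Finset.sum_subset (Finset.Ioc_subset_Ioc_right h) fun k _ hk' ↦ ?_
  rw [Nat.div_eq_of_lt (by simp at *; omega)]
  simp

theorem psi_sub_psi_div_six_le_log_factorial (N : ℕ) :
    ψ N - ψ (N / 6 : ℕ) ≤ Real.log N.factorial + Real.log (N / 30).factorial
      - Real.log (N / 2).factorial - Real.log (N / 3).factorial
      - Real.log (N / 5).factorial := by
  have h₆ : ψ (N / 6 : ℕ) = ∑ k ∈ Ioc 0 N, if k ≤ N / 6 then Λ k else 0 := by
    rw [Chebyshev.psi, Nat.floor_natCast, ← Finset.sum_filter]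
    refine Finset.sum_congr ?_ fun _ _ ↦ rfl
    ext k
    simp only [mem_Ioc, mem_filter]
    omega
  rw [h₆, Chebyshev.psi, Nat.floor_natCast, log_factorial_eq_sum_vonMangoldt le_rfl,
    log_factorial_eq_sum_vonMangoldt (Nat.div_le_self N 30),
    log_factorial_eq_sum_vonMangoldt (Nat.div_le_self N 2),
    log_factorial_eq_sum_vonMangoldt (Nat.div_le_self N 3),
    log_factorial_eq_sum_vonMangoldt (Nat.div_le_self N 5), ← sum_sub_distrib,
    ← sum_add_distrib, ← sum_sub_distrib, ← sum_sub_distrib, ← sum_sub_distrib]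
  refine Finset.sum_le_sum fun k hk ↦ ?_
  rw [Finset.mem_Ioc] at hk
  simp only [Nat.div_div_eq_div_mul, mul_comm _ k]
  simp only [← Nat.div_div_eq_div_mul]
  have hΛ := ArithmeticFunction.vonMangoldt_nonneg (n := k)
  have hk6 : k ≤ N / 6 ↔ 6 ≤ N / k := by
    rw [Nat.le_div_iff_mul_le (by norm_num), Nat.le_div_iff_mul_le hk.1, mul_comm]
  have hk1 : 1 ≤ N / k := (Nat.le_div_iff_mul_le hk.1).2 (by omega)
  simp only [hk6]
  generalize N / k = m at hk1
  rw [← mul_add, ← mul_sub, ← mul_sub, ← mul_sub]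
  split_ifs with h
  · rw [sub_self]
    refine mul_nonneg hΛ ?_
    have : m / 2 + m / 3 + m / 5 ≤ m + m / 30 := by omega
    have : ((m / 2 : ℕ) : ℝ) + (m / 3 : ℕ) + (m / 5 : ℕ) ≤ m + (m / 30 : ℕ) := by exact_mod_cast this
    linarith
  · rw [sub_zero]
    refine le_mul_of_one_le_right hΛ ?_
    have : m / 2 + m / 3 + m / 5 + 1 ≤ m + m / 30 := by omega
    have : ((m / 2 : ℕ) : ℝ) + (m / 3 : ℕ) + (m / 5 : ℕ) + 1 ≤ m + (m / 30 : ℕ) := by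
      exact_mod_cast this
    linarith

theorem mul_log_sub_self_le {y z : ℝ} (hy : 1 ≤ y) (hyz : y ≤ z) :
    y * Real.log y - y ≤ z * Real.log z - z := by
  have hy₀ : 0 < y := by linarith
  have hz : 0 < z := by linarith
  have h := Real.one_sub_inv_le_log_of_pos (x := z / y) (by positivity)
  rw [Real.log_div (by positivity) (by positivity), inv_div] at h
  have h₂ : z * (1 - y / z) = z - y := by field_simp
  have := mul_le_mul_of_nonneg_left h hz.le
  nlinarith [mul_nonneg (sub_nonneg.2 hyz) (Real.log_nonneg hy)]

theorem log_factorial_floor_le {y : ℝ} {m : ℕ} (hm : 1 ≤ m) (hmy : (m : ℝ) ≤ y) :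
    Real.log m.factorial ≤ y * Real.log y - y + 1 + Real.log y := by
  have hm' : (1 : ℝ) ≤ m := by exact_mod_cast hm
  have key : Real.log m.factorial ≤ m * Real.log m - m + 1 + Real.log m := by
    clear hmy hm'
    induction m, hm using Nat.le_induction with
    | base => simp
    | succ m hm ih =>
      have hm' : (0 : ℝ) < m := by exact_mod_cast hm
      have h := Real.one_sub_inv_le_log_of_pos (x := ((m : ℝ) + 1) / m) (by positivity)
      rw [Real.log_div (by positivity) (by positivity), inv_div] at h
      have h₂ : ((m : ℝ) + 1) * (1 - m / (m + 1)) = 1 := by field_simp; ring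
      have := mul_le_mul_of_nonneg_left h (by positivity : (0 : ℝ) ≤ m + 1)
      rw [Nat.factorial_succ]
      push_cast
      rw [Real.log_mul (by positivity) (by positivity)]
      nlinarith
  have h₁ := mul_log_sub_self_le hm' hmy
  have h₂ : Real.log m ≤ Real.log y := Real.log_le_log (by linarith) hmy
  linarith

theorem le_log_factorial_floor {y : ℝ} {m : ℕ} (hy : 1 ≤ y) (hmy : (m : ℝ) ≤ y)
    (hym : y ≤ m + 1) :
    y * Real.log y - y - Real.log (y + 1) ≤ Real.log m.factorial := by
  have h := Stirling.le_log_factorial_stirling (Nat.succ_ne_zero m)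
  have hf : Real.log (m.succ.factorial) = Real.log (m + 1) + Real.log m.factorial := by
    rw [Nat.factorial_succ]
    push_cast
    rw [Real.log_mul (by positivity) (by positivity)]
  rw [hf] at h
  push_cast at h
  have h₁ := mul_log_sub_self_le hy hym
  have h₂ : Real.log (m + 1) ≤ Real.log (y + 1) := Real.log_le_log (by positivity) (by linarith)
  have h₃ : 0 ≤ Real.log ((m : ℝ) + 1) := Real.log_nonneg (by linarith [m.cast_nonneg (α := ℝ)])
  have h₄ : 0 ≤ Real.log (2 * Real.pi) := Real.log_nonneg (by linarith [Real.pi_gt_three])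
  linarith

theorem psi_sub_psi_div_six_le {N : ℕ} (hN : 30 ≤ N) :
    ψ N - ψ (N / 6 : ℕ) ≤ 0.9213 * N + 5 * Real.log N := by
  have hN' : (30 : ℝ) ≤ N := by exact_mod_cast hN
  have hdiv (k : ℕ) (hk : 0 < k) : ((N / k : ℕ) : ℝ) ≤ N / k ∧ (N : ℝ) / k ≤ (N / k : ℕ) + 1 := by
    refine ⟨Nat.cast_div_le, ?_⟩
    rw [div_le_iff₀ (by exact_mod_cast hk)]
    exact_mod_cast (Nat.lt_mul_of_div_lt (Nat.lt_succ_self _) hk).le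
  have hlower (k : ℕ) (hk : 2 ≤ k) (hk' : k ≤ 30) :
      (N : ℝ) / k * (Real.log N - Real.log k) - N / k - Real.log N ≤
        Real.log (N / k).factorial := by
    have hk₀ : (2 : ℝ) ≤ k := by exact_mod_cast hk
    have hk₁ : (k : ℝ) ≤ 30 := by exact_mod_cast hk'
    have h := le_log_factorial_floor (y := (N : ℝ) / k)
      ((one_le_div (by positivity)).2 (by linarith)) (hdiv k (by omega)).1 (hdiv k (by omega)).2
    rw [Real.log_div (by positivity) (by positivity)] at h
    have : Real.log ((N : ℝ) / k + 1) ≤ Real.log N := by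
      refine Real.log_le_log (by positivity) ?_
      have : (N : ℝ) / k ≤ N / 2 := by gcongr
      linarith
    linarith
  have h₁ := log_factorial_floor_le (y := N) (by omega) le_rfl
  have h₃₀ := log_factorial_floor_le (m := N / 30) (by omega) (hdiv 30 (by norm_num)).1
  have h₂ := hlower 2 (by norm_num) (by norm_num)
  have h₃ := hlower 3 (by norm_num) (by norm_num)
  have h₅ := hlower 5 (by norm_num) (by norm_num)
  have h := psi_sub_psi_div_six_le_log_factorial N
  have hl : Real.log (30 : ℝ) = Real.log 2 + Real.log 3 + Real.log 5 := by
    rw [← Real.log_mul (by norm_num) (by norm_num), ← Real.log_mul (by norm_num) (by norm_num)]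
    norm_num
  push_cast at h₂ h₃ h₅ h₃₀
  rw [Real.log_div (by positivity) (by norm_num), hl] at h₃₀
  have hA : Real.log 2 * (1 / 2 - 1 / 30) + Real.log 3 * (1 / 3 - 1 / 30)
      + Real.log 5 * (1 / 5 - 1 / 30) ≤ 0.9213 := by
    linarith [Real.log_two_lt_d9, Real.log_three_lt_d9, Real.log_five_lt_d9]
  have hA' := mul_le_mul_of_nonneg_left hA (by positivity : (0 : ℝ) ≤ N)
  linarith [Real.log_two_gt_d9, Real.log_three_gt_d9, Real.log_five_gt_d9]

theorem psi_le_1_13_mul_add (N : ℕ) : ψ N ≤ 1.13 * N + 10240 := by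
  induction N using Nat.strong_induction_on with
  | _ N ih =>
    rcases le_or_gt N 1900 with h | h
    · have h' : (N : ℝ) ≤ 1900 := by exact_mod_cast h
      have h₁ := Chebyshev.psi_le_const_mul_self (x := N) (by positivity)
      have h₂ : Real.log 4 = 2 * Real.log 2 := by
        rw [show (4 : ℝ) = 2 ^ 2 by norm_num, Real.log_pow]; norm_num
      rw [h₂] at h₁
      nlinarith [Real.log_two_lt_d9, Real.log_two_gt_d9]
    · have h' : (1900 : ℝ) ≤ N := by exact_mod_cast h.le
      have h₁ := ih (N / 6) (by omega)
      have h₂ := psi_sub_psi_div_six_le (N := N) (by omega)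
      have h₃ : ((N / 6 : ℕ) : ℝ) ≤ N / 6 := Nat.cast_div_le
      have h₄ : Real.log N ≤ Real.log 1920 + (N / 1920 - 1) := by
        have := Real.log_le_sub_one_of_pos (x := (N : ℝ) / 1920) (by positivity)
        rw [Real.log_div (by positivity) (by norm_num)] at this
        linarith
      have h₅ : Real.log 1920 = 7 * Real.log 2 + Real.log 3 + Real.log 5 := by
        rw [show (1920 : ℝ) = 2 ^ 7 * 3 * 5 by norm_num, Real.log_mul (by norm_num) (by norm_num),
          Real.log_mul (by norm_num) (by norm_num), Real.log_pow]
        norm_num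
      linarith [Real.log_two_lt_d9, Real.log_three_lt_d9, Real.log_five_lt_d9]

theorem theta_le_1_13_mul_add {x : ℝ} (hx : 0 ≤ x) : θ x ≤ 1.13 * x + 10240 := by
  have h := psi_le_1_13_mul_add ⌊x⌋₊
  rw [← Chebyshev.psi_eq_psi_coe_floor] at h
  linarith [Chebyshev.theta_le_psi x, Nat.floor_le hx]

theorem hasDerivAt_mul_div_log_sq_sub {a b t : ℝ} (ht : 1 < t) :
    HasDerivAt (fun t ↦ a * t / Real.log t ^ 2 - b / Real.log t)
      (a * (1 / Real.log t ^ 2 - 2 / Real.log t ^ 3) + b / (t * Real.log t ^ 2)) t := by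
  have ht₀ : t ≠ 0 := by linarith
  have hl : Real.log t ≠ 0 := (Real.log_pos ht).ne'
  have h := Real.hasDerivAt_log ht₀
  have h₁ := (((hasDerivAt_id t).const_mul a).div (h.pow 2) (pow_ne_zero 2 hl)).sub
    ((hasDerivAt_const t b).div h hl)
  convert! h₁ using 1
  simp
  field_simp
  ring

theorem eight_le_log_3000 : 8 ≤ Real.log 3000 := by
  have h : Real.log 3000 = 3 * Real.log 2 + Real.log 3 + 3 * Real.log 5 := by
    rw [show (3000 : ℝ) = 2 ^ 3 * 3 * 5 ^ 3 by norm_num, Real.log_mul (by norm_num) (by norm_num),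
      Real.log_mul (by norm_num) (by norm_num), Real.log_pow, Real.log_pow]
    norm_num
  linarith [Real.log_two_gt_d9, Real.log_three_gt_d9, Real.log_five_gt_d9]

theorem integral_theta_div_le {x : ℝ} (hx : 3000 ≤ x) :
    ∫ t in 3000..x, θ t / (t * Real.log t ^ 2) ≤
      113 / 75 * x / Real.log x ^ 2 - 10240 / Real.log x + 1280 := by
  have h := intervalIntegral.integral_le_sub_of_hasDeriv_right_of_le
    (g := fun t ↦ 113 / 75 * t / Real.log t ^ 2 - 10240 / Real.log t)
    (φ := fun t ↦ θ t / (t * Real.log t ^ 2)) hx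
    (fun t ht ↦ (hasDerivAt_mul_div_log_sq_sub
      (by linarith [ht.1])).continuousAt.continuousWithinAt)
    (fun t ht ↦ (hasDerivAt_mul_div_log_sq_sub (by linarith [ht.1])).hasDerivWithinAt)
    ((Chebyshev.integrableOn_theta_div_id_mul_log_sq x).mono_set
      (Set.Icc_subset_Icc_left (by norm_num))) ?_
  · refine h.trans ?_
    have h₁ : 10240 / Real.log 3000 ≤ 1280 := by
      rw [div_le_iff₀ (by linarith [eight_le_log_3000])]
      linarith [eight_le_log_3000]
    have h₂ : 0 ≤ 113 / 75 * 3000 / Real.log 3000 ^ 2 := by positivity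
    linarith
  · intro t ht
    have ht₀ : 0 < t := by linarith [ht.1]
    have hl : 8 ≤ Real.log t :=
      eight_le_log_3000.trans (Real.log_le_log (by norm_num) ht.1.le)
    have hl₀ : 0 < Real.log t := by linarith
    calc θ t / (t * Real.log t ^ 2) ≤ (1.13 * t + 10240) / (t * Real.log t ^ 2) := by
          gcongr
          exact theta_le_1_13_mul_add ht₀.le
      _ = 1.13 / Real.log t ^ 2 + 10240 / (t * Real.log t ^ 2) := by field_simp
      _ ≤ _ := by
          gcongr
          have h₁ : 2 / Real.log t ^ 3 ≤ 1 / 4 / Real.log t ^ 2 := by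
            rw [div_div, div_le_div_iff₀ (by positivity) (by positivity)]
            nlinarith [pow_pos hl₀ 2]
          have h₂ : 1.13 / Real.log t ^ 2 =
              113 / 75 * (1 / Real.log t ^ 2 - 1 / 4 / Real.log t ^ 2) := by
            field_simp
            norm_num
          rw [h₂]
          gcongr

theorem primeCounting_3000_le : π 3000 ≤ 1500 := by
  calc π 3000 ≤ π 6 + Nat.totient 6 * (2994 / 6 + 1) :=
        Nat.primeCounting_add_le (k := 6) (by norm_num) le_rfl 2994
    _ ≤ 1500 := by decide

theorem log_3000000 : Real.log 3000000 = 6 * Real.log 2 + Real.log 3 + 6 * Real.log 5 := by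
  rw [show (3000000 : ℝ) = 2 ^ 6 * 3 * 5 ^ 6 by norm_num,
    Real.log_mul (by norm_num) (by norm_num),
    Real.log_mul (by norm_num) (by norm_num), Real.log_pow, Real.log_pow]
  norm_num

theorem le_log_of_3000000_le {x : ℝ} (hx : 3000000 ≤ x) : 14.914 ≤ Real.log x := by
  have h := Real.log_le_log (by norm_num) hx
  rw [log_3000000] at h
  linarith [Real.log_two_gt_d9, Real.log_three_gt_d9, Real.log_five_gt_d9]

theorem log_le_of_3000000_le {x : ℝ} (hx : 3000000 ≤ x) :
    Real.log x ≤ 14.92 * (x / 3000000) := by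
  have h := Real.log_le_sub_one_of_pos (x := x / 3000000) (by positivity)
  rw [Real.log_div (by positivity) (by norm_num), log_3000000] at h
  linarith [Real.log_two_lt_d9, Real.log_three_lt_d9, Real.log_five_lt_d9]

theorem primeCounting_mul_log_le {n : ℕ} (hn : 3000000 ≤ n) :
    π n * Real.log n ≤ 1.25 * n := by
  have hn' : (3000000 : ℝ) ≤ n := by exact_mod_cast hn
  have h₁ := Chebyshev.primeCounting_eq_theta_div_log_add_integral (x := n) (by linarith)
  have h₂ := Chebyshev.primeCounting_eq_theta_div_log_add_integral (x := 3000) (by norm_num)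
  have hint (a b : ℝ) (ha : 2 ≤ a) (hab : a ≤ b) : IntervalIntegrable
      (fun t ↦ θ t / (t * Real.log t ^ 2)) MeasureTheory.volume a b := by
    rw [intervalIntegrable_iff_integrableOn_Icc_of_le hab]
    exact (Chebyshev.integrableOn_theta_div_id_mul_log_sq b).mono_set
      (Set.Icc_subset_Icc_left ha)
  rw [← intervalIntegral.integral_add_adjacent_intervals (hint 2 3000 le_rfl (by norm_num))
    (hint 3000 n (by norm_num) (by linarith))] at h₁
  have h₃ := integral_theta_div_le (x := n) (by linarith)
  rw [Nat.floor_natCast] at h₁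
  rw [show ⌊(3000 : ℝ)⌋₊ = 3000 by norm_num] at h₂
  have h₄ : (π 3000 : ℝ) ≤ 1500 := by exact_mod_cast primeCounting_3000_le
  have h₅ : 0 ≤ θ 3000 / Real.log 3000 :=
    div_nonneg (Chebyshev.theta_nonneg _) (Real.log_nonneg (by norm_num))
  have hL := le_log_of_3000000_le hn'
  have hL₀ : 0 < Real.log n := by linarith
  have h₆ : θ n / Real.log n ≤ 1.13 * n / Real.log n + 10240 / Real.log n := by
    rw [← add_div]
    gcongr
    exact theta_le_1_13_mul_add (by positivity)
  have h₇ : (π n : ℝ) ≤ 1.13 * n / Real.log n + 113 / 75 * n / Real.log n ^ 2 + 2780 := by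
    linarith
  calc (π n : ℝ) * Real.log n ≤
        (1.13 * n / Real.log n + 113 / 75 * n / Real.log n ^ 2 + 2780) * Real.log n := by gcongr
    _ = 1.13 * n + 113 / 75 * n / Real.log n + 2780 * Real.log n := by field_simp
    _ ≤ 1.13 * n + 113 / 75 * n / 14.914 + 2780 * (14.92 * (n / 3000000)) := by
        gcongr
        exact log_le_of_3000000_le hn'
    _ ≤ 1.25 * n := by
        norm_num
        linarith

theorem one_sub_inv_prime_pos {p : ℕ} (hp : p.Prime) : (0 : ℝ) < 1 - (p : ℝ)⁻¹ :=
  sub_pos.2 (inv_lt_one_of_one_lt₀ (by exact_mod_cast hp.one_lt))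

theorem totient_eq_mul_prod_primeFactors (n : ℕ) :
    (n.totient : ℝ) = n * ∏ p ∈ n.primeFactors, (1 - (p : ℝ)⁻¹) := by
  have h := congrArg (Rat.cast : ℚ → ℝ) (Nat.totient_eq_mul_prod_factors n)
  push_cast at h
  exact h

theorem log_18_bounds : 2.89 ≤ Real.log 18 ∧ Real.log 18 ≤ 2.8904 := by
  rw [show (18 : ℝ) = 2 * 3 ^ 2 by norm_num, Real.log_mul (by norm_num) (by norm_num),
    Real.log_pow]
  norm_num
  constructor <;> linarith [Real.log_two_gt_d9, Real.log_three_gt_d9, Real.log_two_lt_d9,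
    Real.log_three_lt_d9]

theorem log_one_sub_inv_add_log_div_nonneg {p : ℝ} (hp : 19 ≤ p) :
    0 ≤ Real.log (1 - p⁻¹) + Real.log p / 50 := by
  have hp₀ : 0 < p := by linarith
  have h₀ : 1 - p⁻¹ = (p - 1) / p := by field_simp
  have h₁ := Real.one_sub_inv_le_log_of_pos (x := (p - 1) / p) (div_pos (by linarith) hp₀)
  have h₂ : 1 - ((p - 1) / p)⁻¹ = - (1 / (p - 1)) := by
    have : p - 1 ≠ 0 := by linarith
    field_simp
    ring
  have h₃ : 1 / (p - 1) ≤ 1 / 18 := by gcongr; linarith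
  have h₄ := Real.log_le_log (by norm_num) (show (18 : ℝ) ≤ p by linarith)
  rw [h₀]
  linarith [log_18_bounds.1]

theorem log_one_sub_inv_add_log_div_nonpos {p : ℝ} (hp₁ : 2 ≤ p) (hp : p ≤ 17) :
    Real.log (1 - p⁻¹) + Real.log p / 50 ≤ 0 := by
  have h₁ := Real.log_le_sub_one_of_pos (x := 1 - p⁻¹)
    (sub_pos.2 (inv_lt_one_of_one_lt₀ (by linarith)))
  have h₂ : (17 : ℝ)⁻¹ ≤ p⁻¹ := by gcongr
  have h₃ := Real.log_le_log (by linarith) (show p ≤ 18 by linarith)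
  linarith [log_18_bounds.2]

theorem le_log_prod_one_sub_inv {n : ℕ} (hn : n ≠ 0) :
    Real.log (∏ p ∈ ({2, 3, 5, 7, 11, 13, 17} : Finset ℕ), (1 - (p : ℝ)⁻¹))
        + (13.134 - Real.log n) / 50 ≤
      Real.log (∏ p ∈ n.primeFactors, (1 - (p : ℝ)⁻¹)) := by
  set S : Finset ℕ := {2, 3, 5, 7, 11, 13, 17} with hS
  have hSp : ∀ p ∈ S, p.Prime := by
    intro p hp
    simp only [hS, mem_insert, mem_singleton] at hp
    rcases hp with rfl | rfl | rfl | rfl | rfl | rfl | rfl <;> norm_num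
  have hS17 : ∀ p ∈ S, 2 ≤ p ∧ p ≤ 17 := by decide
  have hlog : 13.134 ≤ ∑ p ∈ S, Real.log p := by
    rw [← Real.log_prod (fun p hp ↦ by exact_mod_cast (hSp p hp).ne_zero)]
    have h₁ : ∏ p ∈ S, (p : ℝ) = 510510 := by
      rw [hS]
      norm_num
    have h₂ := Real.log_le_log (by norm_num) (show (506250 : ℝ) ≤ 510510 by norm_num)
    rw [show (506250 : ℝ) = 2 * 3 ^ 4 * 5 ^ 5 by norm_num, Real.log_mul (by norm_num) (by norm_num),
      Real.log_mul (by norm_num) (by norm_num), Real.log_pow, Real.log_pow] at h₂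
    rw [h₁]
    norm_num at h₂
    linarith [Real.log_two_gt_d9, Real.log_three_gt_d9, Real.log_five_gt_d9]
  have hrad : ∑ p ∈ n.primeFactors, Real.log p ≤ Real.log n := by
    rw [← Real.log_prod (fun p hp ↦ by
      exact_mod_cast (Nat.prime_of_mem_primeFactors hp).ne_zero), ← Nat.cast_prod]
    have h := Nat.le_of_dvd (Nat.pos_of_ne_zero hn) (Nat.prod_primeFactors_dvd n)
    have h₀ : 0 < ∏ p ∈ n.primeFactors, p :=
      Finset.prod_pos fun p hp ↦ (Nat.prime_of_mem_primeFactors hp).pos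
    exact Real.log_le_log (by exact_mod_cast h₀) (by exact_mod_cast h)
  have hsum : ∑ p ∈ S, (Real.log (1 - (p : ℝ)⁻¹) + Real.log p / 50) ≤
      ∑ p ∈ n.primeFactors, (Real.log (1 - (p : ℝ)⁻¹) + Real.log p / 50) := by
    calc _ ≤ ∑ p ∈ S ∩ n.primeFactors, (Real.log (1 - (p : ℝ)⁻¹) + Real.log p / 50) := by
          rw [← Finset.sum_inter_add_sum_sdiff S n.primeFactors]
          refine add_le_of_nonpos_right (Finset.sum_nonpos fun p hp ↦ ?_)
          obtain ⟨h₁, h₂⟩ := hS17 p (Finset.mem_sdiff.1 hp).1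
          exact log_one_sub_inv_add_log_div_nonpos (by exact_mod_cast h₁) (by exact_mod_cast h₂)
      _ ≤ _ := by
          refine Finset.sum_le_sum_of_subset_of_nonneg Finset.inter_subset_right fun p hp hp' ↦ ?_
          have hpp := Nat.prime_of_mem_primeFactors hp
          have hpS : p ∉ S := fun h ↦ hp' (Finset.mem_inter.2 ⟨h, hp⟩)
          have : 19 ≤ p := by
            by_contra! h
            interval_cases p <;> revert hpp hpS <;> decide
          exact log_one_sub_inv_add_log_div_nonneg (by exact_mod_cast this)
  rw [Finset.sum_add_distrib, Finset.sum_add_distrib, ← Finset.sum_div, ← Finset.sum_div] at hsum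
  rw [Real.log_prod fun p hp ↦ (one_sub_inv_prime_pos (hSp p hp)).ne',
    Real.log_prod fun p hp ↦ (one_sub_inv_prime_pos (Nat.prime_of_mem_primeFactors hp)).ne']
  linarith

theorem le_prod_one_sub_inv {n : ℕ} (hn : n ≠ 0) :
    0.1805 * (1 + (13.134 - Real.log n) / 50) ≤ ∏ p ∈ n.primeFactors, (1 - (p : ℝ)⁻¹) := by
  have h := le_log_prod_one_sub_inv hn
  have hpos : 0 < ∏ p ∈ n.primeFactors, (1 - (p : ℝ)⁻¹) :=
    Finset.prod_pos fun p hp ↦ one_sub_inv_prime_pos (Nat.prime_of_mem_primeFactors hp)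
  have hS : (0.1805 : ℝ) ≤ ∏ p ∈ ({2, 3, 5, 7, 11, 13, 17} : Finset ℕ), (1 - (p : ℝ)⁻¹) := by
    norm_num
  rw [Real.le_log_iff_exp_le hpos, Real.exp_add, Real.exp_log (by linarith)] at h
  refine le_trans ?_ h
  calc _ ≤ 0.1805 * Real.exp ((13.134 - Real.log n) / 50) := by
        gcongr
        linarith [Real.add_one_le_exp ((13.134 - Real.log n) / 50)]
    _ ≤ _ := by gcongr

theorem two_mul_card_lt_of_odd {s : Finset ℕ} {a : ℕ} (hs : ∀ p ∈ s, Odd p ∧ 3 ≤ p ∧ p < a)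
    (ha : Odd a) (ha₃ : 3 ≤ a) : 2 * s.card + 3 ≤ a := by
  have : s ⊆ (Finset.range ((a - 3) / 2)).image fun k ↦ 2 * k + 3 := by
    intro p hp
    obtain ⟨⟨k, rfl⟩, h₃, h⟩ := hs p hp
    obtain ⟨l, rfl⟩ := ha
    exact Finset.mem_image.2 ⟨k - 1, by simp; omega, by omega⟩
  have := (Finset.card_le_card this).trans Finset.card_image_le
  rw [Finset.card_range] at this
  omega

theorem one_div_le_prod_one_sub_inv_sq (s : Finset ℕ) (hs : ∀ p ∈ s, Odd p ∧ 3 ≤ p) :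
    1 / (2 * s.card + 1 : ℝ) ≤ (∏ p ∈ s, (1 - (p : ℝ)⁻¹)) ^ 2 := by
  induction s using Finset.induction_on_max with
  | empty => simp
  | insert a s hlt ih =>
    have has : a ∉ s := fun h ↦ (hlt a h).false
    obtain ⟨ha, ha₃⟩ := hs a (Finset.mem_insert_self a s)
    have hs' : ∀ p ∈ s, Odd p ∧ 3 ≤ p := fun p hp ↦ hs p (Finset.mem_insert_of_mem hp)
    have hcard : (2 * s.card + 3 : ℝ) ≤ a := by
      exact_mod_cast two_mul_card_lt_of_odd
        (fun p hp ↦ ⟨(hs' p hp).1, (hs' p hp).2, hlt p hp⟩) ha ha₃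
    have hc : (0 : ℝ) ≤ s.card := by positivity
    have hstep : (2 * s.card + 1 : ℝ) / (2 * s.card + 3) ≤ (1 - (a : ℝ)⁻¹) ^ 2 := by
      have ha₀ : (0 : ℝ) < a := by linarith
      have h₁ : (2 * s.card + 1 : ℝ) / (2 * s.card + 3) = 1 - 2 / (2 * s.card + 3) := by
        field_simp
        ring
      have h₂ : 2 / (a : ℝ) ≤ 2 / (2 * s.card + 3) := by gcongr
      rw [h₁]
      rw [div_eq_mul_inv 2 (a : ℝ)] at h₂
      nlinarith [sq_nonneg (a : ℝ)⁻¹]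
    rw [Finset.prod_insert has, Finset.card_insert_of_notMem has, mul_pow]
    push_cast
    calc 1 / (2 * ((s.card : ℝ) + 1) + 1) =
          (2 * s.card + 1 : ℝ) / (2 * s.card + 3) * (1 / (2 * s.card + 1)) := by
          field_simp
          ring
      _ ≤ _ := by
          gcongr
          exact ih hs'

theorem card_primeFactors_erase_two_le {n : ℕ} (hn : n ≠ 0) :
    ((n.primeFactors.erase 2).card : ℝ) * 1.0986 ≤ Real.log n := by
  have h₁ : ∏ p ∈ n.primeFactors.erase 2, 3 ≤ ∏ p ∈ n.primeFactors.erase 2, p := by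
    refine Finset.prod_le_prod' fun p hp ↦ ?_
    obtain ⟨h₂, hp⟩ := Finset.mem_erase.1 hp
    have := (Nat.prime_of_mem_primeFactors hp).two_le
    omega
  have h₂ : ∏ p ∈ n.primeFactors.erase 2, p ∣ n :=
    (Finset.prod_dvd_prod_of_subset _ _ _ (Finset.erase_subset _ _)).trans
      (Nat.prod_primeFactors_dvd n)
  have h₃ := h₁.trans (Nat.le_of_dvd (Nat.pos_of_ne_zero hn) h₂)
  rw [Finset.prod_const] at h₃
  have h₄ : ((3 : ℝ) ^ (n.primeFactors.erase 2).card) ≤ n := by exact_mod_cast h₃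
  have h₅ := Real.log_le_log (by positivity) h₄
  rw [Real.log_pow] at h₅
  refine le_trans ?_ h₅
  gcongr
  linarith [Real.log_three_gt_d9]

theorem one_div_le_four_mul_prod_one_sub_inv_sq {n : ℕ} (hn : n ≠ 0) (h₂ : Even n) :
    1 / (2 * (Real.log n / 1.0986) + 1) ≤
      4 * (∏ p ∈ n.primeFactors, (1 - (p : ℝ)⁻¹)) ^ 2 := by
  have hmem : 2 ∈ n.primeFactors := Nat.mem_primeFactors.2 ⟨Nat.prime_two, h₂.two_dvd, hn⟩
  rw [← Finset.mul_prod_erase _ _ hmem, mul_pow]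
  have h := one_div_le_prod_one_sub_inv_sq (n.primeFactors.erase 2) fun p hp ↦ by
    obtain ⟨hp₂, hp⟩ := Finset.mem_erase.1 hp
    have hpp := Nat.prime_of_mem_primeFactors hp
    exact ⟨hpp.odd_of_ne_two hp₂, by have := hpp.two_le; omega⟩
  have hc := card_primeFactors_erase_two_le hn
  rw [← le_div_iff₀ (by norm_num)] at hc
  calc _ ≤ 1 / (2 * ((n.primeFactors.erase 2).card : ℝ) + 1) := by gcongr
    _ ≤ _ := h
    _ = _ := by push_cast; ring

theorem lt_log_mul_prod_one_sub_inv {n : ℕ} (hn : 3000000 ≤ n) (h₂ : Even n) :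
    2.5 < Real.log n * ∏ p ∈ n.primeFactors, (1 - (p : ℝ)⁻¹) := by
  have hL := le_log_of_3000000_le (x := n) (by exact_mod_cast hn)
  have hpos : 0 < ∏ p ∈ n.primeFactors, (1 - (p : ℝ)⁻¹) :=
    Finset.prod_pos fun p hp ↦ one_sub_inv_prime_pos (Nat.prime_of_mem_primeFactors hp)
  have h₁ := le_prod_one_sub_inv (n := n) (by omega)
  have h₃ := one_div_le_four_mul_prod_one_sub_inv_sq (n := n) (by omega) h₂
  generalize Real.log n = L at *
  generalize ∏ p ∈ n.primeFactors, (1 - (p : ℝ)⁻¹) = R at *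
  rcases le_or_gt L 48 with h | h
  · have := mul_le_mul_of_nonneg_left h₁ (by linarith : 0 ≤ L)
    nlinarith [mul_nonneg (sub_nonneg.2 hL) (sub_nonneg.2 h)]
  · rw [div_le_iff₀ (by positivity)] at h₃
    refine lt_of_pow_lt_pow_left₀ 2 (by positivity) ?_
    have h₄ : 25 * (2 * (L / 1.0986) + 1) < L ^ 2 := by
      have : L / 1.0986 ≤ 0.9103 * L := by
        rw [div_le_iff₀ (by norm_num)]
        linarith
      nlinarith
    have := mul_lt_mul_of_pos_right h₄ (pow_pos hpos 2)
    rw [mul_pow]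
    linarith

theorem two_mul_primeCounting_lt_totient {n : ℕ} (hn : 3000000 ≤ n) (h₂ : Even n) :
    2 * π n < n.totient := by
  have hL := le_log_of_3000000_le (x := n) (by exact_mod_cast hn)
  have h₁ := primeCounting_mul_log_le hn
  have h₃ := lt_log_mul_prod_one_sub_inv hn h₂
  have hn₀ : (0 : ℝ) < n := by positivity
  have h₄ := mul_lt_mul_of_pos_left h₃ hn₀
  have h₅ : (2 * π n : ℝ) * Real.log n < n.totient * Real.log n := by
    rw [totient_eq_mul_prod_primeFactors]
    linarith
  exact_mod_cast lt_of_mul_lt_mul_right h₅ (by linarith)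

theorem finite_primeTypeP (n : ℕ) : {p : ℕ | PrimeTypeP n p}.Finite :=
  (Set.finite_lt_nat n).subset fun p hp ↦ by
    have : p < n - 2 := hp.2.2.1
    simp only [Set.mem_ofPred_eq]
    omega

theorem finite_compositeTypeP (n : ℕ) : {x : ℕ | CompositeTypeP n x}.Finite :=
  (Set.finite_lt_nat n).subset fun x hx ↦ by
    have : x < n - 2 := hx.2.2.1
    simp only [Set.mem_ofPred_eq]
    omega

theorem ncard_primeTypeP_lt_primeCounting {n : ℕ} (hn : 2 ≤ n) :
    {p : ℕ | PrimeTypeP n p}.ncard < π n := by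
  rw [← Nat.primesLE_card_eq_primeCounting, ← Set.ncard_coe_finset]
  refine Set.ncard_lt_ncard (Set.ssubset_iff_of_subset ?_ |>.2 ⟨2, ?_, ?_⟩) (Finset.finite_toSet _)
  · rintro p ⟨hp, -, hlt, -⟩
    exact Nat.mem_primesLE.2 ⟨by omega, hp⟩
  · exact Nat.mem_primesLE.2 ⟨hn, Nat.prime_two⟩
  · rintro ⟨-, h, -⟩
    omega

theorem primeTypeP_of_coprime {n p a : ℕ} (hn : Even n) (hco : n.Coprime a) (ha : 0 < a)
    (han : a < n - 2) (hp : p.Prime) (hpa : p ∣ a) : PrimeTypeP n p := by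
  have hpn : ¬ p ∣ n := fun h ↦ hp.one_lt.ne' (Nat.eq_one_of_dvd_coprimes hco h hpa)
  refine ⟨hp, ?_, (Nat.le_of_dvd ha hpa).trans_lt han, hpn⟩
  have h₂ : p ≠ 2 := by
    rintro rfl
    exact hpn hn.two_dvd
  have := hp.two_le
  omega

theorem totient_le_ncard_add_ncard {n : ℕ} (hn : Even n) (h₂ : 2 < n) :
    n.totient ≤ {x : ℕ | CompositeTypeP n x}.ncard + {p : ℕ | PrimeTypeP n p}.ncard + 2 := by
  have hsub : (((Finset.range n).filter n.Coprime : Finset ℕ) : Set ℕ) ⊆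
      {x : ℕ | CompositeTypeP n x} ∪ {p : ℕ | PrimeTypeP n p} ∪ {1, n - 1} := by
    intro a ha
    simp only [Finset.coe_filter, Finset.mem_range, Set.mem_ofPred_eq] at ha
    obtain ⟨han, hco⟩ := ha
    by_cases h₁ : a = 1 ∨ a = n - 1
    · exact Or.inr h₁
    have ha₀ : a ≠ 0 := by
      rintro rfl
      simp at hco
      omega
    have ha₂ : ¬ 2 ∣ a := fun h ↦ by
      simpa using Nat.eq_one_of_dvd_coprimes hco hn.two_dvd h
    have hlt : a < n - 2 := by
      have := hn.two_dvd
      omega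
    have hP (p : ℕ) (hp : p.Prime) (hpa : p ∣ a) : PrimeTypeP n p :=
      primeTypeP_of_coprime hn hco (by omega) hlt hp hpa
    by_cases hp : a.Prime
    · exact Or.inl (Or.inr (hP a hp dvd_rfl))
    · exact Or.inl (Or.inl ⟨by omega, hp, hlt, hP⟩)
  rw [Nat.totient_eq_card_coprime, ← Set.ncard_coe_finset]
  refine (Set.ncard_le_ncard hsub
    (((finite_compositeTypeP n).union (finite_primeTypeP n)).union (Set.toFinite _))).trans ?_
  refine (Set.ncard_union_le _ _).trans ?_
  gcongr
  · exact Set.ncard_union_le _ _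
  · exact (Set.ncard_insert_le _ _).trans (by simp)

/-- For every even integer `2N ≥ 3 × 10^6`, the number `s` of composites of type P
relative to `2N` is strictly greater than the number `h` of primes of type P
relative to `2N`: `card X_{2N} > card P_{2N}`. -/
theorem stmt_5 (n : ℕ) (hn : Even n) (h6 : 3 * 10 ^ 6 ≤ n) :
    Set.ncard {x : ℕ | CompositeTypeP n x} > Set.ncard {p : ℕ | PrimeTypeP n p} := by
  have h₁ := totient_le_ncard_add_ncard hn (by omega)
  have h₂ := ncard_primeTypeP_lt_primeCounting (n := n) (by omega)
  have h₃ := two_mul_primeCounting_lt_totient (by omega) hn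
  omega
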